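/- Let 𝔊 be an affine Lie algebra and P a parabolic subset of Δ of type Ib with finite-dimensional Levi factor 𝔊_P⁰, and let 𝔪_P and N_P be the associated subalgebras. Then 𝔪̃_P = 𝔪_P ⊕ N_P is a parabolic subalgebra of 𝔊 of type II, and 𝔊 = N_P⁻ ⊕ 𝔪_P ⊕ N_P, where N_P⁻ is the opposite algebra to N_P. -/

import Mathlib

open Module Function

set_option autoImplicit false

/-! ### Bundled Lie representations over ℂ -/

/-- A bundled representation (Lie module) of a complex Lie algebra `K`. -/
structure LieRep (K : Type) [LieRing K] [LieAlgebra ℂ K] : Type 1 where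
  V : Type
  [iA : AddCommGroup V]
  [iM : Module ℂ V]
  [iB : LieRingModule K V]
  [iL : LieModule ℂ K V]

attribute [instance] LieRep.iA LieRep.iM LieRep.iB LieRep.iL

/-- A linear map from a `K`-module to an `L`-module (for `K` a subalgebra of `L`)
is equivariant if it intertwines the `K`-actions. -/
def LieRep.IsEquivariant {L : Type} [LieRing L] [LieAlgebra ℂ L] (K : LieSubalgebra ℂ L)
    (N : LieRep K) (M : LieRep L) (f : N.V →ₗ[ℂ] M.V) : Prop :=
  ∀ (k : K) (n : N.V), f ⁅k, n⁆ = ⁅(k : L), f n⁆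

/-- `M`, together with the canonical map `ι : N → M`, is the induced module
`ind(K, L; N) = U(L) ⊗_{U(K)} N`, characterized by the universal property that
`L`-module maps out of `M` correspond exactly to `K`-module maps out of `N`. -/
structure LieRep.IsInduced {L : Type} [LieRing L] [LieAlgebra ℂ L] (K : LieSubalgebra ℂ L)
    (N : LieRep K) (M : LieRep L) (ι : N.V →ₗ[ℂ] M.V) : Prop where
  equivariant : LieRep.IsEquivariant K N M ι
  universal : ∀ (X : LieRep L) (f : N.V →ₗ[ℂ] X.V), LieRep.IsEquivariant K N X f →
    ∃! g : M.V →ₗ[ℂ] X.V, (∀ (x : L) (m : M.V), g ⁅x, m⁆ = ⁅x, g m⁆) ∧ g.comp ι = f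

/-- `X` is (isomorphic to) the unique irreducible quotient `L_P(N)` of the induced module
`ind(K, L; N)`: every realization of the induced module admits an equivariant epimorphism
onto `X`. -/
def LieRep.IsIrreducibleQuotientOfInduced {L : Type} [LieRing L] [LieAlgebra ℂ L]
    (K : LieSubalgebra ℂ L) (N : LieRep K) (X : LieRep L) : Prop :=
  LieModule.IsIrreducible ℂ L X.V ∧
    ∀ (M : LieRep L) (ι : N.V →ₗ[ℂ] M.V), LieRep.IsInduced K N M ι →
      ∃ g : M.V →ₗ[ℂ] X.V, (∀ (x : L) (m : M.V), g ⁅x, m⁆ = ⁅x, g m⁆) ∧ Surjective g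

/-- The subrepresentation attached to a Lie submodule. -/
def LieRep.sub {K : Type} [LieRing K] [LieAlgebra ℂ K] (N : LieRep K)
    (U : LieSubmodule ℂ K N.V) : LieRep K := ⟨U⟩

/-- Restriction of a representation of a Lie subalgebra `K` to a smaller subalgebra `K₀ ≤ K`. -/
def LieRep.restrict {L : Type} [LieRing L] [LieAlgebra ℂ L] {K K₀ : LieSubalgebra ℂ L}
    (h : K₀ ≤ K) (N : LieRep K) : LieRep K₀ where
  V := N.V
  iB := LieRingModule.compLieHom N.V (LieSubalgebra.inclusion h)
  iL := LieModule.compLieHom N.V (LieSubalgebra.inclusion h)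

/-- The restriction of a representation of `L` to a Lie subalgebra `K`. -/
def LieRep.restrictL {L : Type} [LieRing L] [LieAlgebra ℂ L] (K : LieSubalgebra ℂ L)
    (M : LieRep L) : LieRep K := ⟨M.V⟩
/-! ### Affine Kac–Moody algebras (axiomatized) -/

/-- An axiomatization of an affine Kac–Moody Lie algebra over `ℂ` (untwisted or twisted):
a complex Lie algebra together with a Cartan subalgebra `H` with
`dim H = rank + 2`, a one-dimensional centre spanned by the canonical central element `c`,
and the indivisible (positive) imaginary root `δ`. -/
structure AffineKacMoody : Type 1 where
  L : Type
  [instLieRing : LieRing L]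
  [instLieAlgebra : LieAlgebra ℂ L]
  H : LieSubalgebra ℂ L
  isCartan : H.IsCartanSubalgebra
  /-- the rank of the associated finite-dimensional simple Lie algebra;
  (the affine algebra has `rank + 1` simple roots and `dim H = rank + 2`). -/
  rank : ℕ
  rank_eq : Module.finrank ℂ H = rank + 2
  /-- the canonical central element spanning the centre -/
  c : L
  c_mem : c ∈ H
  c_ne : c ≠ 0
  c_central : ∀ x : L, ⁅c, x⁆ = 0
  center_le : ∀ z : L, (∀ x : L, ⁅z, x⁆ = 0) → ∃ a : ℂ, z = a • c
  /-- the indivisible positive imaginary root -/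
  δ : Dual ℂ H

attribute [instance] AffineKacMoody.instLieRing AffineKacMoody.instLieAlgebra

namespace AffineKacMoody

variable (A : AffineKacMoody)

/-- The weight space of weight `χ : H* → ℂ` in an `L`-module `M`
(with respect to the Cartan subalgebra `H`). -/
def wtSp (M : Type) [AddCommGroup M] [Module ℂ M] [LieRingModule A.L M] [LieModule ℂ A.L M]
    (χ : Dual ℂ A.H) : Submodule ℂ M where
  carrier := {m | ∀ h : A.H, ⁅(h : A.L), m⁆ = χ h • m}
  add_mem' := by
    intro a b ha hb h
    rw [lie_add, ha h, hb h, smul_add]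
  zero_mem' := by intro h; rw [lie_zero, smul_zero]
  smul_mem' := by
    intro t m hm h
    rw [lie_smul, hm h, smul_comm]

/-- A weight module over `𝔊`: the sum of the weight spaces is everything. -/
def IsWeightModL (M : Type) [AddCommGroup M] [Module ℂ M] [LieRingModule A.L M]
    [LieModule ℂ A.L M] : Prop :=
  (⨆ χ : Dual ℂ A.H, A.wtSp M χ) = ⊤

/-- The weight space of weight `χ` in a module over a subalgebra `K` containing `H`. -/
def wtSpK (K : LieSubalgebra ℂ A.L) (hH : A.H ≤ K) (V : Type) [AddCommGroup V] [Module ℂ V]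
    [LieRingModule K V] [LieModule ℂ K V] (χ : Dual ℂ A.H) : Submodule ℂ V where
  carrier := {v | ∀ h : A.H, ⁅(⟨h.1, hH h.2⟩ : K), v⁆ = χ h • v}
  add_mem' := by
    intro a b ha hb h
    rw [lie_add, ha h, hb h, smul_add]
  zero_mem' := by intro h; rw [lie_zero, smul_zero]
  smul_mem' := by
    intro t m hm h
    rw [lie_smul, hm h, smul_comm]

/-- A weight module over a subalgebra `K ⊇ H`. -/
def IsWeightModK (K : LieSubalgebra ℂ A.L) (hH : A.H ≤ K) (V : Type) [AddCommGroup V]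
    [Module ℂ V] [LieRingModule K V] [LieModule ℂ K V] : Prop :=
  (⨆ χ : Dual ℂ A.H, A.wtSpK K hH V χ) = ⊤

/-- The root space of `α ∈ H*`. -/
def rootSp (α : Dual ℂ A.H) : Submodule ℂ A.L := A.wtSp A.L α

/-- The root system `Δ` of `𝔊`. -/
def Δ : Set (Dual ℂ A.H) := {α | α ≠ 0 ∧ A.rootSp α ≠ ⊥}

/-- The set of imaginary roots `{kδ : k ∈ ℤ ∖ {0}}`. -/
def Δim : Set (Dual ℂ A.H) := {β | ∃ k : ℤ, k ≠ 0 ∧ β = (k : ℂ) • A.δ}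

/-- The set of real roots. -/
def Δre : Set (Dual ℂ A.H) := A.Δ \ A.Δim

/-- The axioms tying the data of `AffineKacMoody` together: root space decomposition
`𝔊 = H ⊕ (⊕_{α ∈ Δ} 𝔊_α)`, and the description of the imaginary roots as the
nonzero integral multiples of `δ`. -/
def IsAffine : Prop :=
  A.wtSp A.L 0 = A.H.toSubmodule ∧
  (⨆ χ : Dual ℂ A.H, A.wtSp A.L χ) = ⊤ ∧
  A.Δim ⊆ A.Δ ∧
  (∀ β ∈ A.Δ, (∃ t : ℂ, β = t • A.δ) → β ∈ A.Δim)

/-- The subalgebra generated by `H` together with the root spaces `𝔊_β`, `β ∈ T`. -/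
def algOf (T : Set (Dual ℂ A.H)) : LieSubalgebra ℂ A.L :=
  LieSubalgebra.lieSpan ℂ A.L ((A.H : Set A.L) ∪ ⋃ β ∈ T, (A.rootSp β : Set A.L))

/-- The subalgebra generated by the root spaces `𝔊_β`, `β ∈ T` (without `H`). -/
def nilOf (T : Set (Dual ℂ A.H)) : LieSubalgebra ℂ A.L :=
  LieSubalgebra.lieSpan ℂ A.L (⋃ β ∈ T, (A.rootSp β : Set A.L))

/-- The Heisenberg subalgebra `G`, generated by the imaginary root spaces. -/
def heis : LieSubalgebra ℂ A.L := A.nilOf A.Δim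

/-- The derived subalgebra `⁅K, K⁆` of a subalgebra. -/
def derivedOf (K : LieSubalgebra ℂ A.L) : LieSubalgebra ℂ A.L :=
  LieSubalgebra.lieSpan ℂ A.L {x | ∃ a ∈ K, ∃ b ∈ K, ⁅a, b⁆ = x}

theorem H_le_algOf (T : Set (Dual ℂ A.H)) : A.H ≤ A.algOf T := fun _ hx =>
  LieSubalgebra.subset_lieSpan (Set.mem_union_left _ hx)

theorem c_mem_algOf (T : Set (Dual ℂ A.H)) : A.c ∈ A.algOf T := A.H_le_algOf T A.c_mem

theorem nilOf_mono {T T' : Set (Dual ℂ A.H)} (h : T ⊆ T') : A.nilOf T ≤ A.nilOf T' :=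
  LieSubalgebra.lieSpan_mono <| Set.biUnion_subset_biUnion_left h

theorem nilOf_le_algOf {T T' : Set (Dual ℂ A.H)} (h : T ⊆ T') : A.nilOf T ≤ A.algOf T' :=
  LieSubalgebra.lieSpan_mono <|
    le_trans (Set.biUnion_subset_biUnion_left h) (Set.subset_union_right)

theorem algOf_mono {T T' : Set (Dual ℂ A.H)} (h : T ⊆ T') : A.algOf T ≤ A.algOf T' :=
  LieSubalgebra.lieSpan_mono <|
    Set.union_subset_union_right _ (Set.biUnion_subset_biUnion_left h)

theorem heis_le_algOf {T : Set (Dual ℂ A.H)} (h : A.Δim ⊆ T) : A.heis ≤ A.algOf T :=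
  A.nilOf_le_algOf h

/-! ### Parabolic subsets and parabolic subalgebras -/

/-- A set of roots is closed if it is closed under root addition. -/
def IsClosedRoots (P : Set (Dual ℂ A.H)) : Prop :=
  ∀ α ∈ P, ∀ β ∈ P, α + β ∈ A.Δ → α + β ∈ P

/-- A parabolic subset of the root system: a closed subset `P ⊆ Δ` with `P ∪ (−P) = Δ`. -/
structure IsParabolic (P : Set (Dual ℂ A.H)) : Prop where
  subset : P ⊆ A.Δ
  closed : A.IsClosedRoots P
  covers : A.Δ ⊆ P ∪ (-P)

/-- A partition of the root system: a closed subset `P` with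
`P ∩ (−P) = ∅` and `P ∪ (−P) = Δ`. -/
structure IsPartition (P : Set (Dual ℂ A.H)) : Prop where
  subset : P ⊆ A.Δ
  closed : A.IsClosedRoots P
  covers : A.Δ ⊆ P ∪ (-P)
  disjoint : P ∩ (-P) = ∅

/-- The parabolic subalgebra `𝔊_P` attached to a parabolic subset `P`
(also the Borel subalgebra `𝔅_P` when `P` is a partition). -/
def gP (P : Set (Dual ℂ A.H)) : LieSubalgebra ℂ A.L := A.algOf P

/-- The Levi factor `𝔊_P⁰` of the parabolic subalgebra `𝔊_P`. -/
def gP0 (P : Set (Dual ℂ A.H)) : LieSubalgebra ℂ A.L := A.algOf (P ∩ (-P))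

/-- The nilradical `𝔊_P⁺` of the parabolic subalgebra `𝔊_P`. -/
def gPplus (P : Set (Dual ℂ A.H)) : LieSubalgebra ℂ A.L := A.nilOf (P \ (-P))

/-- The opposite nilradical `𝔊_P⁻`. -/
def gPminus (P : Set (Dual ℂ A.H)) : LieSubalgebra ℂ A.L := A.nilOf (-(P \ (-P)))

theorem gP0_le_gP (P : Set (Dual ℂ A.H)) : A.gP0 P ≤ A.gP P :=
  A.algOf_mono Set.inter_subset_left

theorem gPplus_le_gP (P : Set (Dual ℂ A.H)) : A.gPplus P ≤ A.gP P :=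
  A.nilOf_le_algOf Set.diff_subset

theorem H_le_gP (P : Set (Dual ℂ A.H)) : A.H ≤ A.gP P := A.H_le_algOf P

theorem c_mem_gP (P : Set (Dual ℂ A.H)) : A.c ∈ A.gP P := A.c_mem_algOf P

theorem c_mem_gP0 (P : Set (Dual ℂ A.H)) : A.c ∈ A.gP0 P := A.c_mem_algOf _

/-- A parabolic subalgebra has type II if its Levi factor contains the Heisenberg
subalgebra, i.e. all imaginary roots lie in `P⁰ = P ∩ (−P)`. -/
def IsTypeII (P : Set (Dual ℂ A.H)) : Prop :=
  A.IsParabolic P ∧ A.Δim ⊆ P ∩ (-P)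

end AffineKacMoody
namespace AffineKacMoody

variable (A : AffineKacMoody)

/-- The subalgebra `ℂc`. -/
def cLine : LieSubalgebra ℂ A.L where
  carrier := (Submodule.span ℂ {A.c} : Submodule ℂ A.L)
  add_mem' := fun hx hy => Submodule.add_mem _ hx hy
  smul_mem' := fun t _ hx => Submodule.smul_mem _ t hx
  zero_mem' := Submodule.zero_mem _
  lie_mem' := by
    intro x y hx _
    rcases Submodule.mem_span_singleton.mp hx with ⟨a, rfl⟩
    have : ⁅a • A.c, y⁆ = (0 : A.L) := by rw [smul_lie, A.c_central, smul_zero]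
    rw [this]; exact Submodule.zero_mem _

/-- The data of a pseudo parabolic subalgebra attached to a type II parabolic subset `P`:
the subalgebra `G(𝒫) ⊆ G` (the orthogonal complement of the Heisenberg subalgebra of
`[𝒫₀, 𝒫₀]`, determined by `G(𝒫) + ([𝒫₀,𝒫₀] ∩ G) = G` and `G(𝒫) ∩ [𝒫₀,𝒫₀] = ℂc`),
together with a triangular decomposition `G(𝒫) = G(𝒫)₋ ⊕ ℂc ⊕ G(𝒫)₊`. -/
structure PseudoParabolicData (P : Set (Dual ℂ A.H)) : Type 1 where
  typeII : A.IsTypeII P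
  GP : LieSubalgebra ℂ A.L
  Gplus : LieSubalgebra ℂ A.L
  Gminus : LieSubalgebra ℂ A.L
  GP_le_heis : GP ≤ A.heis
  c_mem_GP : A.c ∈ GP
  compl_sup : GP.toSubmodule ⊔ (A.heis.toSubmodule ⊓ (A.derivedOf (A.gP0 P)).toSubmodule)
      = A.heis.toSubmodule
  compl_inf : GP.toSubmodule ⊓ (A.derivedOf (A.gP0 P)).toSubmodule = Submodule.span ℂ {A.c}
  Gplus_le : Gplus ≤ GP
  Gminus_le : Gminus ≤ GP
  tri_sup : Gminus.toSubmodule ⊔ Submodule.span ℂ {A.c} ⊔ Gplus.toSubmodule = GP.toSubmodule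
  tri_inf₁ : Gplus.toSubmodule ⊓ Gminus.toSubmodule = ⊥
  tri_inf₂ : (Gplus.toSubmodule ⊔ Gminus.toSubmodule) ⊓ Submodule.span ℂ {A.c} = ⊥

namespace PseudoParabolicData

variable {A} {P : Set (Dual ℂ A.H)}

/-- The Levi factor `𝒫₀^{ps}` of the pseudo parabolic subalgebra: generated by `H` and
the real root spaces `𝔊_α`, `α ∈ P ∩ (−P) ∩ Δ^{re}`. -/
def P0ps (_D : A.PseudoParabolicData P) : LieSubalgebra ℂ A.L :=
  A.algOf ((P ∩ (-P)) ∩ A.Δre)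

/-- The nilradical `𝔑^{ps}` of the pseudo parabolic subalgebra: generated by `G(𝒫)₊`
together with the root spaces `𝔊_α`, `α ∈ P ∖ (−P)`. -/
def Nps (D : A.PseudoParabolicData P) : LieSubalgebra ℂ A.L :=
  LieSubalgebra.lieSpan ℂ A.L ((D.Gplus : Set A.L) ∪ ⋃ β ∈ P \ (-P), (A.rootSp β : Set A.L))

/-- The pseudo parabolic subalgebra `𝒫^{ps} = 𝒫₀^{ps} ⊕ 𝔑^{ps}`. -/
def Pps (D : A.PseudoParabolicData P) : LieSubalgebra ℂ A.L := D.P0ps ⊔ D.Nps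

theorem H_le_P0ps (D : A.PseudoParabolicData P) : A.H ≤ D.P0ps := A.H_le_algOf _

theorem P0ps_le_Pps (D : A.PseudoParabolicData P) : D.P0ps ≤ D.Pps := le_sup_left

theorem Nps_le_Pps (D : A.PseudoParabolicData P) : D.Nps ≤ D.Pps := le_sup_right

theorem H_le_Pps (D : A.PseudoParabolicData P) : A.H ≤ D.Pps :=
  le_trans (H_le_P0ps D) (P0ps_le_Pps D)

theorem c_mem_Pps (D : A.PseudoParabolicData P) : A.c ∈ D.Pps :=
  H_le_Pps D A.c_mem

theorem Nps_le_gP (D : A.PseudoParabolicData P) : D.Nps ≤ A.gP P := by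
  apply LieSubalgebra.lieSpan_le.mpr
  apply Set.union_subset
  · refine le_trans ?_ (A.heis_le_algOf (le_trans D.typeII.2 Set.inter_subset_left))
    refine le_trans (le_trans D.Gplus_le D.GP_le_heis) ?_
    intro x hx; exact hx
  · refine le_trans (Set.biUnion_subset_biUnion_left (Set.diff_subset)) ?_
    intro x hx
    exact LieSubalgebra.subset_lieSpan (Set.mem_union_right _ hx)

end PseudoParabolicData

end AffineKacMoody
namespace AffineKacMoody

variable (A : AffineKacMoody)

/-- The central element `c` acts injectively on a module over a subalgebra `K ∋ c`. -/
def cInj (K : LieSubalgebra ℂ A.L) (hc : A.c ∈ K) (V : LieRep K) : Prop :=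
  Function.Injective fun v : V.V => ⁅(⟨A.c, hc⟩ : K), v⁆

/-- The central element `c` acts injectively on an `𝔊`-module. -/
def cInjL (M : LieRep A.L) : Prop :=
  Function.Injective fun m : M.V => ⁅A.c, m⁆

/-- The subalgebra `K' ≤ K` acts trivially on a `K`-module. -/
def TrivialOn (K K' : LieSubalgebra ℂ A.L) (h : K' ≤ K) (V : LieRep K) : Prop :=
  ∀ (x : A.L) (hx : x ∈ K') (v : V.V), ⁅(⟨x, h hx⟩ : K), v⁆ = 0

/-- Weight module (for a module over a subalgebra `K ⊇ H`). -/
def IsWeightRep (K : LieSubalgebra ℂ A.L) (hH : A.H ≤ K) (V : LieRep K) : Prop :=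
  A.IsWeightModK K hH V.V

/-- Weight module, for an `𝔊`-module. -/
def IsWeightRepL (M : LieRep A.L) : Prop := A.IsWeightModL M.V

/-- The set of weights of a module over a subalgebra `K ⊇ H`. -/
def wtsOf (K : LieSubalgebra ℂ A.L) (hH : A.H ≤ K) (V : LieRep K) : Set (Dual ℂ A.H) :=
  {χ | A.wtSpK K hH V.V χ ≠ ⊥}

/-- The space `M^{𝔑}` of `K'`-invariants (`𝒫`-primitive elements together with `0`)
of an `𝔊`-module. -/
def nilInv (K' : LieSubalgebra ℂ A.L) (M : LieRep A.L) : Submodule ℂ M.V where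
  carrier := {m | ∀ x ∈ K', ⁅x, m⁆ = 0}
  add_mem' := by
    intro a b ha hb x hx
    rw [lie_add, ha x hx, hb x hx, add_zero]
  zero_mem' := by intro x _; rw [lie_zero]
  smul_mem' := by
    intro t m hm x hx
    rw [lie_smul, hm x hx, smul_zero]

/-- The intersection of a subalgebra `K'` with `K`, viewed as a Lie subalgebra of `K`. -/
def within (K K' : LieSubalgebra ℂ A.L) : LieSubalgebra ℂ K where
  carrier := {x | (x : A.L) ∈ K'}
  add_mem' := by intro x y hx hy; simpa using K'.add_mem hx hy
  smul_mem' := by intro t x hx; simpa using K'.smul_mem t hx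
  zero_mem' := by simp
  lie_mem' := by intro x y hx hy; simpa using K'.lie_mem hx hy

/-- A module `N` over the subalgebra `𝔊(Δ₀)` (generated by `H` and the root spaces of a
symmetric subset `Δ₀`) is *cuspidal* if it is not isomorphic to a parabolically induced
module `L_Q(N')` for any proper parabolic subset `Q` of `Δ₀`. -/
def IsCuspidalOn (Δ₀ : Set (Dual ℂ A.H)) (N : LieRep (A.algOf Δ₀)) : Prop :=
  ¬ ∃ Q : Set (Dual ℂ A.H), (Q ⊆ Δ₀ ∧ A.IsClosedRoots Q ∧ Δ₀ ⊆ Q ∪ (-Q) ∧ Q ≠ Δ₀) ∧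
    ∃ N' : LieRep (A.within (A.algOf Δ₀) (A.algOf Q)),
      LieRep.IsIrreducibleQuotientOfInduced (A.within (A.algOf Δ₀) (A.algOf Q)) N' N

/-- An irreducible weight `𝔊`-module is cuspidal if it is not parabolically induced. -/
def IsCuspidalL (X : LieRep A.L) : Prop :=
  ¬ ∃ P : Set (Dual ℂ A.H), A.IsParabolic P ∧ P ≠ A.Δ ∧
    ∃ N : LieRep (A.gP P), LieRep.IsIrreducibleQuotientOfInduced (A.gP P) N X

/-- `(M, v)` is the Verma type module `M_P(λ)` attached to the Borel subalgebra `𝔅_P` of a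
partition `P` and `λ ∈ H*` (with `λ(c) ≠ 0` in applications): `v` is a weight vector of
weight `λ` annihilated by `𝔑_P`, and `(M, v)` is universal with these properties. -/
structure IsVermaType (P : Set (Dual ℂ A.H)) (lam : Dual ℂ A.H) (M : LieRep A.L) (v : M.V) :
    Prop where
  weight : v ∈ A.wtSp M.V lam
  prim : ∀ x ∈ A.nilOf P, ⁅x, v⁆ = 0
  universal : ∀ (X : LieRep A.L) (w : X.V), w ∈ A.wtSp X.V lam →
    (∀ x ∈ A.nilOf P, ⁅x, w⁆ = 0) →
    ∃! g : M.V →ₗ[ℂ] X.V, (∀ (x : A.L) (m : M.V), g ⁅x, m⁆ = ⁅x, g m⁆) ∧ g v = w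

/-! ### Oriented flags -/

/-- An oriented flag of subspaces of `W = Span_ℝ(Δ) ⊆ H*`: a strictly decreasing chain
`F 0 = W ⊃ F 1 ⊃ ⋯ ⊃ F len`, where each `F (i+1)` is cut out of `F i` by the orientation
functional `φ i`; the two connected components of `F i ∖ F (i+1)` are the sets where
`φ i` is positive (the `+` component), resp. negative. -/
structure OrientedFlag : Type where
  len : ℕ
  F : ℕ → Submodule ℝ (Dual ℂ A.H)
  φ : ℕ → (Dual ℂ A.H →ₗ[ℝ] ℝ)
  F_zero : F 0 = Submodule.span ℝ A.Δ
  strict : ∀ i < len, F (i + 1) < F i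
  hyper : ∀ i < len, F (i + 1) = F i ⊓ LinearMap.ker (φ i)

variable {A}

/-- A full oriented flag of maximal length: it reaches `⊥` after `n = dim W` steps. -/
def OrientedFlag.IsFull (Fl : A.OrientedFlag) : Prop :=
  Fl.F Fl.len = ⊥ ∧ Fl.len = Module.finrank ℝ (Submodule.span ℝ A.Δ)

/-- The positive part `∪ᵢ (F_i ∖ F_{i+1})⁺` determined by the orientation. -/
def OrientedFlag.posPart (Fl : A.OrientedFlag) : Set (Dual ℂ A.H) :=
  ⋃ i ∈ Finset.range Fl.len, {β | β ∈ Fl.F i ∧ 0 < Fl.φ i β}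

/-- A full oriented flag of maximal length determines the partition
`P = Δ ∩ (∪ᵢ (F_i ∖ F_{i+1})⁺)`. -/
def OrientedFlag.determines (Fl : A.OrientedFlag) (P : Set (Dual ℂ A.H)) : Prop :=
  Fl.IsFull ∧ P = A.Δ ∩ Fl.posPart

/-- A partial oriented flag (of length `k`) determines the parabolic subset `P` with
`P⁰ = Δ ∩ F k` together with the positive part given by the orientation. -/
def OrientedFlag.determinesPar (Fl : A.OrientedFlag) (P : Set (Dual ℂ A.H)) : Prop :=
  P = (A.Δ ∩ {β | β ∈ Fl.F Fl.len}) ∪ (A.Δ ∩ Fl.posPart)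

variable (A)

/-! ### Bases of the root system and the parabolic subsets `P_S` -/

/-- The set of positive roots determined by a basis `π`. -/
def posRoots (π : Set (Dual ℂ A.H)) : Set (Dual ℂ A.H) :=
  {α | α ∈ A.Δ ∧ α ∈ AddSubmonoid.closure π}

/-- `π` is a basis of the root system `Δ`. -/
structure IsRootBasis (π : Set (Dual ℂ A.H)) : Prop where
  subset : π ⊆ A.Δ
  finite : π.Finite
  card : Nat.card π = A.rank + 1
  indep : LinearIndependent ℂ (fun x : π => (x : Dual ℂ A.H))
  spans : A.Δ ⊆ A.posRoots π ∪ -(A.posRoots π)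
  delta_pos : A.δ ∈ AddSubmonoid.closure π

/-- The distinguished simple root `α₀ ∈ π` with `−α₀ + δ` in the span of the remaining
simple roots and `−α₀ + δ ∈ Δ` or `½(−α₀ + δ) ∈ Δ`. -/
structure IsAffineNode (π : Set (Dual ℂ A.H)) (α₀ : Dual ℂ A.H) : Prop where
  mem : α₀ ∈ π
  in_span : -α₀ + A.δ ∈ AddSubgroup.closure (π \ {α₀})
  root : (-α₀ + A.δ ∈ A.Δ) ∨ ((2⁻¹ : ℂ) • (-α₀ + A.δ) ∈ A.Δ)

/-- `Δ̇₊`: the free semigroup generated by `π̇ = π ∖ {α₀}`. -/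
def dotPlus (π : Set (Dual ℂ A.H)) (α₀ : Dual ℂ A.H) : Set (Dual ℂ A.H) :=
  {β | β ∈ AddSubmonoid.closure (π \ {α₀}) ∧ β ≠ 0}

/-- The root subsystem `S_π` generated by `S` and `δ`. -/
def genSub (S : Set (Dual ℂ A.H)) : Set (Dual ℂ A.H) :=
  {β | β ∈ A.Δ ∧ β ∈ AddSubgroup.closure (S ∪ {A.δ})}

/-- The parabolic subset `P_S = S_π ∪ P₊` of type II, where
`P₊ = {α + nδ | α ∈ Δ̇₊ ∖ S_π, n ∈ ℤ} ∩ Δ`. -/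
def PS (π : Set (Dual ℂ A.H)) (α₀ : Dual ℂ A.H) (S : Set (Dual ℂ A.H)) :
    Set (Dual ℂ A.H) :=
  A.genSub S ∪
    ({γ | ∃ β ∈ A.dotPlus π α₀ \ A.genSub S, ∃ n : ℤ, γ = β + (n : ℂ) • A.δ} ∩ A.Δ)

/-- A subset `S` of a basis is connected (in the sense of the Dynkin diagram: two simple
roots are adjacent iff their sum is a root). -/
def IsConnectedS (S : Set (Dual ℂ A.H)) : Prop :=
  ∀ a ∈ S, ∀ b ∈ S, Relation.ReflTransGen (fun x y => x ∈ S ∧ y ∈ S ∧ x + y ∈ A.Δ) a b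

/-- `Si` is the decomposition of `S` into connected components. -/
structure IsComponents (S : Set (Dual ℂ A.H)) {ι : Type} (Si : ι → Set (Dual ℂ A.H)) :
    Prop where
  union : ⋃ i, Si i = S
  nonempty : ∀ i, (Si i).Nonempty
  disj : Pairwise fun i j => Disjoint (Si i) (Si j)
  connected : ∀ i, A.IsConnectedS (Si i)
  separated : ∀ i j, i ≠ j → ∀ a ∈ Si i, ∀ b ∈ Si j, a + b ∉ A.Δ

end AffineKacMoody
namespace AffineKacMoody

variable (A : AffineKacMoody)

theorem lie_mem_wtSp {α β : Dual ℂ A.H} {x y : A.L} (hx : x ∈ A.wtSp A.L α)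
    (hy : y ∈ A.wtSp A.L β) : ⁅x, y⁆ ∈ A.wtSp A.L (α + β) := by
  intro h
  rw [leibniz_lie, hx h, hy h, smul_lie, lie_smul, LinearMap.add_apply, add_smul]

/-- The sum of the weight spaces of `𝔊` with weights in `X`. -/
def wtSum (X : Set (Dual ℂ A.H)) : Submodule ℂ A.L := ⨆ χ ∈ X, A.wtSp A.L χ

theorem wtSp_le_wtSum {X : Set (Dual ℂ A.H)} {χ : Dual ℂ A.H} (hχ : χ ∈ X) :
    A.wtSp A.L χ ≤ A.wtSum X :=
  le_biSup (A.wtSp A.L) hχ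

theorem wtSum_union (X Y : Set (Dual ℂ A.H)) : A.wtSum (X ∪ Y) = A.wtSum X ⊔ A.wtSum Y :=
  iSup_union

theorem lie_mem_wtSum {X : Set (Dual ℂ A.H)} (hX : ∀ α ∈ X, ∀ β ∈ X, α + β ∈ X) {x y : A.L}
    (hx : x ∈ A.wtSum X) (hy : y ∈ A.wtSum X) : ⁅x, y⁆ ∈ A.wtSum X := by
  have hsum : ∀ α ∈ X, ∀ x ∈ A.wtSp A.L α, ∀ y ∈ A.wtSum X, ⁅x, y⁆ ∈ A.wtSum X := by
    intro α hα x hx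
    have h : A.wtSum X ≤ (A.wtSum X).comap (LieModule.toEnd ℂ A.L A.L x) :=
      iSup₂_le fun β hβ y hy => A.wtSp_le_wtSum (hX α hα β hβ) (A.lie_mem_wtSp hx hy)
    exact h
  have h : A.wtSum X ≤ (A.wtSum X).comap (LieModule.toEnd ℂ A.L A.L y) := by
    refine iSup₂_le fun α hα x hx => ?_
    rw [Submodule.mem_comap, LieModule.toEnd_apply_apply, ← lie_skew]
    exact neg_mem (hsum α hα x hx y hy)
  rw [← lie_skew]
  exact neg_mem (h hx)

/-- The Lie subalgebra formed by the weight spaces with weights in a set closed under addition. -/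
def wtAlg (X : Set (Dual ℂ A.H)) (hX : ∀ α ∈ X, ∀ β ∈ X, α + β ∈ X) : LieSubalgebra ℂ A.L where
  __ := A.wtSum X
  lie_mem' := A.lie_mem_wtSum hX

theorem iSupIndep_wtSp : iSupIndep (A.wtSp A.L) := by
  have : A.H.IsCartanSubalgebra := A.isCartan
  have h := LieSubmodule.iSupIndep_toSubmodule.mpr <|
    (LieModule.iSupIndep_genWeightSpace ℂ A.H A.L).comp
      (DFunLike.coe_injective (F := Dual ℂ A.H))
  exact h.mono fun χ _ hx => LieModule.weightSpace_le_genWeightSpace A.L χ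
    ((LieModule.mem_weightSpace χ _).mpr hx)

theorem disjoint_wtSum {X Y : Set (Dual ℂ A.H)} (h : Disjoint X Y) :
    Disjoint (A.wtSum X) (A.wtSum Y) :=
  A.iSupIndep_wtSp.disjoint_biSup_biSup h

theorem wtSum_le_of_rootSp_le {X T : Set (Dual ℂ A.H)} {K : Submodule ℂ A.L}
    (hXT : ∀ χ ∈ X, χ ∈ A.Δ → χ ∈ T) (hT : ∀ χ ∈ T, A.rootSp χ ≤ K)
    (h0 : (0 : Dual ℂ A.H) ∈ X → A.wtSp A.L 0 ≤ K) : A.wtSum X ≤ K := by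
  refine iSup₂_le fun χ hχ => ?_
  by_cases hχ0 : χ = 0
  · subst hχ0
    exact h0 hχ
  by_cases hbot : A.rootSp χ = ⊥
  · exact hbot.le.trans bot_le
  · exact hT χ (hXT χ hχ ⟨hχ0, hbot⟩)

theorem algOf_toSubmodule_eq_wtSum (hA : A.IsAffine) {X T : Set (Dual ℂ A.H)}
    (hX : ∀ α ∈ X, ∀ β ∈ X, α + β ∈ X) (h0 : (0 : Dual ℂ A.H) ∈ X) (hTX : T ⊆ X)
    (hXT : ∀ χ ∈ X, χ ∈ A.Δ → χ ∈ T) : (A.algOf T).toSubmodule = A.wtSum X := by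
  apply le_antisymm
  · change A.algOf T ≤ A.wtAlg X hX
    refine LieSubalgebra.lieSpan_le.mpr (Set.union_subset ?_ (Set.iUnion₂_subset ?_))
    · exact fun x hx => A.wtSp_le_wtSum h0 (hA.1.ge hx)
    · exact fun β hβ x hx => A.wtSp_le_wtSum (hTX hβ) hx
  · refine A.wtSum_le_of_rootSp_le hXT (fun χ hχ x hx => ?_) (fun _ x hx => ?_)
    · exact LieSubalgebra.subset_lieSpan (Or.inr (Set.mem_biUnion hχ hx))
    · exact A.H_le_algOf T (hA.1.le hx)

theorem nilOf_toSubmodule_eq_wtSum {X T : Set (Dual ℂ A.H)}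
    (hX : ∀ α ∈ X, ∀ β ∈ X, α + β ∈ X) (h0 : (0 : Dual ℂ A.H) ∉ X) (hTX : T ⊆ X)
    (hXT : ∀ χ ∈ X, χ ∈ A.Δ → χ ∈ T) : (A.nilOf T).toSubmodule = A.wtSum X := by
  apply le_antisymm
  · change A.nilOf T ≤ A.wtAlg X hX
    exact LieSubalgebra.lieSpan_le.mpr
      (Set.iUnion₂_subset fun β hβ x hx => A.wtSp_le_wtSum (hTX hβ) hx)
  · exact A.wtSum_le_of_rootSp_le hXT
      (fun χ hχ x hx => LieSubalgebra.subset_lieSpan (Set.mem_biUnion hχ hx)) (absurd · h0)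

namespace OrientedFlag

variable {A} (Fl : A.OrientedFlag)

theorem F_anti {i j : ℕ} (hij : i ≤ j) (hj : j ≤ Fl.len) : Fl.F j ≤ Fl.F i := by
  induction j, hij using Nat.le_induction with
  | base => exact le_rfl
  | succ j _ ih => exact (Fl.strict j hj).le.trans (ih (by omega))

theorem φ_eq_zero {i j : ℕ} (hij : i < j) (hj : j ≤ Fl.len) {β : Dual ℂ A.H} (hβ : β ∈ Fl.F j) :
    Fl.φ i β = 0 := by
  have := Fl.F_anti hij hj hβ
  rw [Fl.hyper i (by omega)] at this
  exact this.2

/-- The weights which are positive with respect to one of the first `s` steps of the flag. -/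
def posBelow (s : ℕ) : Set (Dual ℂ A.H) := {β | ∃ i < s, β ∈ Fl.F i ∧ 0 < Fl.φ i β}

variable {Fl} {s : ℕ} {α β : Dual ℂ A.H}

theorem notMem_F_of_mem_posBelow (hs : s ≤ Fl.len) (hβ : β ∈ Fl.posBelow s) : β ∉ Fl.F s := by
  obtain ⟨i, hi, -, hpos⟩ := hβ
  exact fun h => hpos.ne' (Fl.φ_eq_zero hi hs h)

theorem add_mem_posBelow_of_mem_F (hs : s ≤ Fl.len) (hα : α ∈ Fl.F s)
    (hβ : β ∈ Fl.posBelow s) : α + β ∈ Fl.posBelow s := by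
  obtain ⟨i, hi, hmem, hpos⟩ := hβ
  refine ⟨i, hi, add_mem (Fl.F_anti hi.le hs hα) hmem, ?_⟩
  rwa [map_add, Fl.φ_eq_zero hi hs hα, zero_add]

theorem add_mem_posBelow (hs : s ≤ Fl.len) (hα : α ∈ Fl.posBelow s) (hβ : β ∈ Fl.posBelow s) :
    α + β ∈ Fl.posBelow s := by
  obtain ⟨i, hi, hmem, hpos⟩ := hα
  obtain ⟨j, hj, hmem', hpos'⟩ := hβ
  rcases lt_trichotomy i j with h | rfl | h
  · refine ⟨i, hi, add_mem hmem (Fl.F_anti h.le (by omega) hmem'), ?_⟩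
    rwa [map_add, Fl.φ_eq_zero h (by omega) hmem', add_zero]
  · exact ⟨i, hi, add_mem hmem hmem', by rw [map_add]; exact add_pos hpos hpos'⟩
  · refine ⟨j, hj, add_mem (Fl.F_anti h.le (by omega) hmem) hmem', ?_⟩
    rwa [map_add, Fl.φ_eq_zero h (by omega) hmem, zero_add]

theorem neg_notMem_posBelow (hs : s ≤ Fl.len) (hβ : β ∈ Fl.posBelow s) :
    -β ∉ Fl.posBelow s := fun h =>
  notMem_F_of_mem_posBelow hs (add_mem_posBelow hs hβ h) (by simp)

theorem determinesPar.mem_iff {P : Set (Dual ℂ A.H)} (hFl : Fl.determinesPar P)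
    (hs : s ≤ Fl.len) (hβ : β ∉ Fl.F s) : β ∈ P ↔ β ∈ A.Δ ∧ β ∈ Fl.posBelow s := by
  rw [hFl]
  simp only [posPart, posBelow, Set.mem_union, Set.mem_inter_iff, Set.mem_ofPred_eq,
    Set.mem_iUnion, Finset.mem_range, exists_prop]
  constructor
  · rintro (⟨-, h⟩ | ⟨h, i, hi, hmem, hpos⟩)
    · exact absurd (Fl.F_anti hs le_rfl h) hβ
    · exact ⟨h, i, lt_of_not_ge fun hsi => hβ (Fl.F_anti hsi hi.le hmem), hmem, hpos⟩
  · rintro ⟨h, i, hi, hmem, hpos⟩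
    exact Or.inr ⟨h, i, by omega, hmem, hpos⟩

end OrientedFlag

theorem isParabolic_union_F {P : Set (Dual ℂ A.H)} (hP : A.IsParabolic P) {Fl : A.OrientedFlag}
    (hFl : Fl.determinesPar P) {s : ℕ} (hs : s ≤ Fl.len) :
    A.IsParabolic ({β ∈ A.Δ | β ∈ Fl.F s} ∪ P) where
  subset := Set.union_subset (Set.sep_subset _ _) hP.subset
  closed := by
    have key : ∀ α ∈ Fl.F s, ∀ β ∈ P, α + β ∈ A.Δ →
        α + β ∈ {β ∈ A.Δ | β ∈ Fl.F s} ∪ P := by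
      intro α hα β hβ hΔ
      by_cases hβs : β ∈ Fl.F s
      · exact Or.inl ⟨hΔ, add_mem hα hβs⟩
      · have h := OrientedFlag.add_mem_posBelow_of_mem_F hs hα ((hFl.mem_iff hs hβs).mp hβ).2
        exact Or.inr ((hFl.mem_iff hs (OrientedFlag.notMem_F_of_mem_posBelow hs h)).mpr ⟨hΔ, h⟩)
    rintro α (hα | hα) β (hβ | hβ) hΔ
    · exact Or.inl ⟨hΔ, add_mem hα.2 hβ.2⟩
    · exact key α hα.2 β hβ hΔ
    · rw [add_comm] at hΔ ⊢
      exact key β hβ.2 α hα hΔ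
    · exact Or.inr (hP.closed α hα β hβ hΔ)
  covers := fun β hβ => (hP.covers hβ).imp Or.inr Or.inr

theorem neg_mem_Δim {β : Dual ℂ A.H} (hβ : β ∈ A.Δim) : -β ∈ A.Δim := by
  obtain ⟨k, hk, rfl⟩ := hβ
  exact ⟨-k, neg_ne_zero.mpr hk, by push_cast; rw [neg_smul]⟩

end AffineKacMoody

open AffineKacMoody in
/-- **Proposition (Futorny–Kashuba, Proposition 5).**
Let `𝔊` be an affine Lie algebra and `P` a parabolic subset of `Δ` of type Ib with
finite-dimensional Levi factor `𝔊_P⁰`, with corresponding partial oriented flag `F`, and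
let `s` be the largest index (`1 ≤ s < k`) with `Δ^{im} ⊆ F_s`. Then, with `𝔪_P` the
subalgebra generated by `ℋ` and the root spaces of `F_s ∩ Δ` and `N_P` the span of the
root spaces `𝔊_β`, `β ∈ P`, not contained in `𝔪_P`: `𝔪̃_P = 𝔪_P ⊕ N_P` is a parabolic
subalgebra of `𝔊` of type II and `𝔊 = N_P⁻ ⊕ 𝔪_P ⊕ N_P`. -/
theorem typeIb_extends_to_typeII
    (A : AffineKacMoody) (hA : A.IsAffine)
    (P : Set (Module.Dual ℂ A.H)) (hP : A.IsParabolic P)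
    (Fl : A.OrientedFlag) (hFl : Fl.determinesPar P)
    (hfin : FiniteDimensional ℂ (A.gP0 P))
    (s : ℕ) (hs1 : 1 ≤ s) (hsk : s < Fl.len)
    (him : ∀ β ∈ A.Δim, β ∈ Fl.F s)
    (hlargest : ¬ ∀ β ∈ A.Δim, β ∈ Fl.F (s + 1)) :
    A.IsTypeII ({β ∈ A.Δ | β ∈ Fl.F s} ∪ P) ∧
    (A.gP ({β ∈ A.Δ | β ∈ Fl.F s} ∪ P)).toSubmodule =
      (A.algOf {β ∈ A.Δ | β ∈ Fl.F s}).toSubmodule ⊔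
        (A.nilOf {β ∈ P | β ∉ Fl.F s}).toSubmodule ∧
    (A.algOf {β ∈ A.Δ | β ∈ Fl.F s}).toSubmodule ⊓
        (A.nilOf {β ∈ P | β ∉ Fl.F s}).toSubmodule = ⊥ ∧
    -- `𝔊 = N_P⁻ ⊕ 𝔪_P ⊕ N_P`
    (A.nilOf (-{β ∈ P | β ∉ Fl.F s})).toSubmodule ⊔
        ((A.algOf {β ∈ A.Δ | β ∈ Fl.F s}).toSubmodule ⊔
          (A.nilOf {β ∈ P | β ∉ Fl.F s}).toSubmodule) = ⊤ ∧
    (A.nilOf (-{β ∈ P | β ∉ Fl.F s})).toSubmodule ⊓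
        ((A.algOf {β ∈ A.Δ | β ∈ Fl.F s}).toSubmodule ⊔
          (A.nilOf {β ∈ P | β ∉ Fl.F s}).toSubmodule) = ⊥ := by
  have hs : s ≤ Fl.len := hsk.le
  have hmem {β : Dual ℂ A.H} (h : β ∈ Fl.posBelow s) : β ∉ Fl.F s :=
    OrientedFlag.notMem_F_of_mem_posBelow hs h
  have hpos_add : ∀ α ∈ Fl.posBelow s, ∀ β ∈ Fl.posBelow s, α + β ∈ Fl.posBelow s :=
    fun _ hα _ hβ => OrientedFlag.add_mem_posBelow hs hα hβ
  have hQ := A.isParabolic_union_F hP hFl hs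
  have hm : (A.algOf {β ∈ A.Δ | β ∈ Fl.F s}).toSubmodule = A.wtSum (Fl.F s) :=
    A.algOf_toSubmodule_eq_wtSum hA (fun _ hα _ hβ => add_mem hα hβ) (zero_mem _)
      (fun _ h => h.2) (fun _ h hΔ => ⟨hΔ, h⟩)
  have hN : (A.nilOf {β ∈ P | β ∉ Fl.F s}).toSubmodule = A.wtSum (Fl.posBelow s) :=
    A.nilOf_toSubmodule_eq_wtSum hpos_add (fun h => hmem h (zero_mem _))
      (fun _ h => ((hFl.mem_iff hs h.2).mp h.1).2)
      (fun _ h hΔ => ⟨(hFl.mem_iff hs (hmem h)).mpr ⟨hΔ, h⟩, hmem h⟩)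
  have hNneg : (A.nilOf (-{β ∈ P | β ∉ Fl.F s})).toSubmodule = A.wtSum (-Fl.posBelow s) := by
    refine A.nilOf_toSubmodule_eq_wtSum ?_ ?_ ?_ ?_
    · intro α hα β hβ
      rw [Set.mem_neg, neg_add]
      exact hpos_add _ hα _ hβ
    · rw [Set.mem_neg, neg_zero]
      exact fun h => hmem h (zero_mem _)
    · exact fun χ h => ((hFl.mem_iff hs h.2).mp h.1).2
    · refine fun χ h hΔ => ⟨(hP.covers hΔ).resolve_left fun hχ => ?_, hmem h⟩
      have hχs : χ ∉ Fl.F s := fun h' => hmem h (neg_mem h')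
      exact OrientedFlag.neg_notMem_posBelow hs ((hFl.mem_iff hs hχs).mp hχ).2 h
  have hgP : (A.gP ({β ∈ A.Δ | β ∈ Fl.F s} ∪ P)).toSubmodule =
      A.wtSum (Fl.F s ∪ Fl.posBelow s) := by
    refine A.algOf_toSubmodule_eq_wtSum hA ?_ (Or.inl (zero_mem _)) ?_ ?_
    · rintro α (hα | hα) β (hβ | hβ)
      · exact Or.inl (add_mem hα hβ)
      · exact Or.inr (OrientedFlag.add_mem_posBelow_of_mem_F hs hα hβ)
      · rw [add_comm]
        exact Or.inr (OrientedFlag.add_mem_posBelow_of_mem_F hs hβ hα)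
      · exact Or.inr (hpos_add α hα β hβ)
    · rintro β (hβ | hβ)
      · exact Or.inl hβ.2
      · exact or_iff_not_imp_left.mpr fun h => ((hFl.mem_iff hs h).mp hβ).2
    · rintro β (hβ | hβ) hΔ
      · exact Or.inl ⟨hΔ, hβ⟩
      · exact Or.inr ((hFl.mem_iff hs (hmem hβ)).mpr ⟨hΔ, hβ⟩)
  rw [hgP, hm, hN, hNneg, ← A.wtSum_union, ← A.wtSum_union]
  refine ⟨⟨hQ, fun β hβ => ?_⟩, rfl, ?_, ?_, ?_⟩
  · have hF {γ : Dual ℂ A.H} (hγ : γ ∈ A.Δim) : γ ∈ {β ∈ A.Δ | β ∈ Fl.F s} ∪ P :=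
      Or.inl ⟨hA.2.2.1 hγ, him γ hγ⟩
    exact ⟨hF hβ, hF (A.neg_mem_Δim hβ)⟩
  · exact (A.disjoint_wtSum (Set.disjoint_right.mpr fun _ h => hmem h)).eq_bot
  · rw [← top_le_iff, ← hA.2.1, ← iSup_univ]
    refine A.wtSum_le_of_rootSp_le (fun _ _ hΔ => hΔ) (fun χ hχ => A.wtSp_le_wtSum ?_)
      fun _ => A.wtSp_le_wtSum (Or.inr (Or.inl (zero_mem _)))
    by_cases hχs : χ ∈ Fl.F s
    · exact Or.inr (Or.inl hχs)
    rcases hP.covers hχ with h | h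
    · exact Or.inr (Or.inr ((hFl.mem_iff hs hχs).mp h).2)
    · exact Or.inl ((hFl.mem_iff hs (fun h' => hχs (neg_mem_iff.mp h'))).mp h).2
  · refine (A.disjoint_wtSum (Set.disjoint_left.mpr ?_)).eq_bot
    rintro χ hχ (h | h)
    · exact hmem hχ (neg_mem h)
    · exact OrientedFlag.neg_notMem_posBelow hs h hχ
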